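/- arXiv:math/0509053 — 3 statements merged into one kernel-verified Lean document; each statement's English description precedes it below -/
import Mathlib

section
/- Let sw denote the switch automorphism of the free product ℤ₂ * ℤ₂ interchanging the two free factors. Then every automorphism φ of ℤ₂ * ℤ₂ is either an inner automorphism or the composite of an inner automorphism with sw; that is, the outer automorphism group of ℤ₂ * ℤ₂ has order 2, generated by the class of sw. -/
open Monoid

/-- The group `ℤ₂ * ℤ₂`. -/
abbrev Z2Z2 : Type := Coprod (Multiplicative (ZMod 2)) (Multiplicative (ZMod 2))

/-- The switch automorphism of `ℤ₂ * ℤ₂` interchanging the two free factors. -/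
def switchAut : Z2Z2 ≃* Z2Z2 := MulEquiv.coprodComm _ _

namespace DihedralGroup

theorem eq_zero_of_add_self_eq_zero {i : ZMod 0} (h : i + i = 0) : i = 0 :=
  (show ∀ i : ℤ, i + i = 0 → i = 0 by lia) i h

theorem exists_equiv_r_one (ψ : DihedralGroup 0 ≃* DihedralGroup 0) :
    ∃ k : ZMod 0, ψ (r 1) = r k := by
  rcases h : ψ (r 1) with k | k
  · exact ⟨k, rfl⟩
  · have h2 : ψ (r 1 * r 1) = 1 := by rw [map_mul, h, sr_mul_self]
    rw [map_eq_one_iff ψ ψ.injective, r_mul_r, one_def] at h2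
    exact absurd (eq_zero_of_add_self_eq_zero (r.inj h2)) one_ne_zero

theorem exists_equiv_sr_zero (ψ : DihedralGroup 0 ≃* DihedralGroup 0) :
    ∃ i : ZMod 0, ψ (sr 0) = sr i := by
  rcases h0 : ψ (sr 0) with i | i
  · have h2 : ψ (sr 0 * sr 0) = r (i + i) := by rw [map_mul, h0, r_mul_r]
    rw [sr_mul_self, map_one, one_def] at h2
    rw [eq_zero_of_add_self_eq_zero (r.inj h2).symm, r_zero, map_eq_one_iff ψ ψ.injective] at h0
    cases h0
  · exact ⟨i, rfl⟩

theorem equiv_r_one (ψ : DihedralGroup 0 ≃* DihedralGroup 0) :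
    ψ (r 1) = r 1 ∨ ψ (r 1) = r (-1) := by
  obtain ⟨k, hk⟩ := exists_equiv_r_one ψ
  obtain ⟨m, hm⟩ := exists_equiv_r_one ψ.symm
  have hkm : k * m = 1 := by
    have h : r m = (r 1 : DihedralGroup 0) ^ (m.cast : ℤ) := by
      rw [r_one_zpow, ZMod.intCast_zmod_cast]
    rw [MulEquiv.symm_apply_eq, h, map_zpow, hk, r_zpow, ZMod.intCast_zmod_cast] at hm
    exact (r.inj hm).symm
  have h1 : k = 1 ∨ k = -1 := Int.eq_one_or_neg_one_of_mul_eq_one hkm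
  rcases h1 with rfl | rfl
  · exact .inl hk
  · exact .inr hk

theorem r_conj_sr {n : ℕ} (m j : ZMod n) : r m * sr j * (r m)⁻¹ = sr (j - 2 * m) := by
  rw [inv_r, r_mul_sr, sr_mul_r]
  congr 1
  ring

theorem sr_conj_sr {n : ℕ} (m j : ZMod n) : sr m * sr j * (sr m)⁻¹ = sr (2 * m - j) := by
  rw [inv_sr, sr_mul_sr, r_mul_sr]
  congr 1
  ring

/-- An automorphism of the infinite dihedral group takes the pair of adjacent reflections
`sr 0`, `sr 1` to a conjugate of this pair, possibly in the opposite order. -/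
theorem exists_conj_equiv_sr (ψ : DihedralGroup 0 ≃* DihedralGroup 0) :
    (∃ d, ψ (sr 0) = d * sr 0 * d⁻¹ ∧ ψ (sr 1) = d * sr 1 * d⁻¹) ∨
    (∃ d, ψ (sr 0) = d * sr 1 * d⁻¹ ∧ ψ (sr 1) = d * sr 0 * d⁻¹) := by
  obtain ⟨i, hi⟩ := exists_equiv_sr_zero ψ
  have h1 : ψ (sr 1) = sr i * ψ (r 1) := by rw [← hi, ← map_mul, sr_mul_r, zero_add]
  have h_parity : ∃ m : ZMod 0, i = 2 * m ∨ i = 2 * m + 1 := Int.even_or_odd' i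
  rw [h1, hi]
  obtain ⟨m, rfl | rfl⟩ := h_parity <;> rcases equiv_r_one ψ with h | h <;> rw [h, sr_mul_r]
  · refine .inl ⟨r (-m), ?_, ?_⟩ <;> rw [r_conj_sr] <;> congr 1 <;> ring
  · refine .inl ⟨sr m, ?_, ?_⟩ <;> rw [sr_conj_sr] <;> congr 1 <;> ring
  · refine .inr ⟨sr (m + 1), ?_, ?_⟩ <;> rw [sr_conj_sr] <;> congr 1 <;> ring
  · refine .inr ⟨r (-m), ?_, ?_⟩ <;> rw [r_conj_sr] <;> congr 1 <;> ring

end DihedralGroup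

namespace Z2Z2

open DihedralGroup

/-- The generator of the first factor. -/
def a : Z2Z2 := Coprod.inl (Multiplicative.ofAdd 1)

/-- The generator of the second factor. -/
def b : Z2Z2 := Coprod.inr (Multiplicative.ofAdd 1)

theorem eq_one_or_ofAdd_one (x : Multiplicative (ZMod 2)) :
    x = 1 ∨ x = Multiplicative.ofAdd 1 := by
  revert x; decide

theorem a_mul_a : a * a = 1 := by
  rw [a, ← map_mul]
  exact map_one _

theorem b_mul_b : b * b = 1 := by
  rw [b, ← map_mul]
  exact map_one _

theorem hom_ext {G : Type*} [Monoid G] {f g : Z2Z2 →* G} (ha : f a = g a) (hb : f b = g b) :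
    f = g := by
  refine Coprod.hom_ext (MonoidHom.ext fun x => ?_) (MonoidHom.ext fun x => ?_) <;>
    rcases eq_one_or_ofAdd_one x with rfl | rfl
  · simp only [map_one]
  · exact ha
  · simp only [map_one]
  · exact hb

/-- The homomorphism out of `ZMod 2` determined by an involution. -/
def involutionHom {G : Type*} [Group G] (g : G) (hg : g * g = 1) :
    Multiplicative (ZMod 2) →* G :=
  AddMonoidHom.toMultiplicativeLeft (ZMod.lift 2 ⟨zmultiplesHom (Additive G) (Additive.ofMul g), by
    change Additive.ofMul (g ^ (2 : ℤ)) = 0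
    rw [zpow_two, hg]; rfl⟩)

theorem involutionHom_ofAdd_one {G : Type*} [Group G] (g : G) (hg : g * g = 1) :
    involutionHom g hg (Multiplicative.ofAdd 1) = g := by
  change g ^ (1 : ℤ) = g
  exact zpow_one g

/-- The homomorphism to the infinite dihedral group sending the two generators to adjacent
reflections. -/
def toDihedral : Z2Z2 →* DihedralGroup 0 :=
  Coprod.lift (involutionHom (sr 0) (sr_mul_self 0)) (involutionHom (sr 1) (sr_mul_self 1))

theorem toDihedral_a : toDihedral a = sr 0 :=
  involutionHom_ofAdd_one (sr 0 : DihedralGroup 0) (sr_mul_self 0)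

theorem toDihedral_b : toDihedral b = sr 1 :=
  involutionHom_ofAdd_one (sr 1 : DihedralGroup 0) (sr_mul_self 1)

/-- The element of `ℤ₂ * ℤ₂` corresponding to an element of the infinite dihedral group. -/
def ofDihedral : DihedralGroup 0 → Z2Z2
  | r n => (a * b) ^ (n.cast : ℤ)
  | sr n => a * (a * b) ^ (n.cast : ℤ)

theorem toDihedral_ofDihedral (x : DihedralGroup 0) : toDihedral (ofDihedral x) = x := by
  rcases x with n | n <;>
    simp [ofDihedral, map_zpow, toDihedral_a, toDihedral_b]

theorem a_mul_ofDihedral (x : DihedralGroup 0) :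
    a * ofDihedral x = ofDihedral (sr 0 * x) := by
  rcases x with n | n
  · rw [sr_mul_r, zero_add]; rfl
  · rw [sr_mul_sr, sub_zero]
    simp only [ofDihedral, ← mul_assoc, a_mul_a, one_mul]

theorem b_mul_ofDihedral (x : DihedralGroup 0) :
    b * ofDihedral x = ofDihedral (sr 1 * x) := by
  have hb : b = a * (a * b) := by rw [← mul_assoc, a_mul_a, one_mul]
  have hba : b * a = (a * b)⁻¹ := by
    rw [mul_inv_rev, inv_eq_of_mul_eq_one_right a_mul_a, inv_eq_of_mul_eq_one_right b_mul_b]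
  rcases x with n | n
  · have hn : ((1 + n).cast : ℤ) = 1 + n.cast := rfl
    rw [sr_mul_r, ofDihedral, ofDihedral, hn, zpow_one_add, ← mul_assoc a, ← hb]
  · have hn : ((n - 1).cast : ℤ) = -1 + n.cast := Int.sub_eq_add_neg.trans (Int.add_comm _ _)
    rw [sr_mul_sr, ofDihedral, ofDihedral, hn, zpow_add, zpow_neg_one, ← mul_assoc, hba]

theorem ofDihedral_toDihedral (x : Z2Z2) : ofDihedral (toDihedral x) = x := by
  suffices h : ∀ x y, x * ofDihedral y = ofDihedral (toDihedral x * y) by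
    have h1 : ofDihedral 1 = 1 := zpow_zero _
    simpa [h1] using (h x 1).symm
  intro x
  induction x using Coprod.induction_on with
  | inl x =>
    rcases eq_one_or_ofAdd_one x with rfl | rfl
    · simp
    · intro y
      exact (a_mul_ofDihedral y).trans (by rw [← toDihedral_a]; rfl)
  | inr x =>
    rcases eq_one_or_ofAdd_one x with rfl | rfl
    · simp
    · intro y
      exact (b_mul_ofDihedral y).trans (by rw [← toDihedral_b]; rfl)
  | mul x z hx hz => intro y; rw [mul_assoc, hz, hx, map_mul, mul_assoc]

/-- `ℤ₂ * ℤ₂` is the infinite dihedral group. -/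
def dihedralEquiv : Z2Z2 ≃* DihedralGroup 0 where
  __ := toDihedral
  invFun := ofDihedral
  left_inv := ofDihedral_toDihedral
  right_inv := toDihedral_ofDihedral

theorem dihedralEquiv_a : dihedralEquiv a = sr 0 := toDihedral_a

theorem dihedralEquiv_b : dihedralEquiv b = sr 1 := toDihedral_b

theorem switchAut_a : switchAut a = b := rfl

theorem switchAut_b : switchAut b = a := rfl

/-- Conjugacy of an automorphism `φ` to `σ` may be checked on generators, in the infinite
dihedral group. -/
theorem exists_conj_of_dihedral (φ σ : Z2Z2 ≃* Z2Z2) (d : DihedralGroup 0)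
    (ha : dihedralEquiv (φ a) = d * dihedralEquiv (σ a) * d⁻¹)
    (hb : dihedralEquiv (φ b) = d * dihedralEquiv (σ b) * d⁻¹) :
    ∃ g : Z2Z2, ∀ x, φ x = g * σ x * g⁻¹ := by
  refine ⟨dihedralEquiv.symm d, DFunLike.congr_fun
    (hom_ext (f := φ.toMonoidHom)
      (g := (MulAut.conj (dihedralEquiv.symm d)).toMonoidHom.comp σ.toMonoidHom) ?_ ?_)⟩ <;>
    apply dihedralEquiv.injective <;> simpa

end Z2Z2

/-- Every automorphism of `ℤ₂ * ℤ₂` is inner, or the composite of an inner automorphism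
with the switch automorphism `sw`; i.e. `Out(ℤ₂ * ℤ₂) ≅ ℤ₂`, generated by the class
of `sw`.  (The switch automorphism itself is not inner, so the outer automorphism group
has order exactly 2.) -/
theorem out_z2z2_order_two :
    (∀ φ : Z2Z2 ≃* Z2Z2,
      (∃ g : Z2Z2, ∀ x, φ x = g * x * g⁻¹) ∨
      (∃ g : Z2Z2, ∀ x, φ x = g * switchAut x * g⁻¹)) ∧
    ¬ ∃ g : Z2Z2, ∀ x, switchAut x = g * x * g⁻¹ := by
  refine ⟨fun φ => ?_, fun ⟨g, hg⟩ => ?_⟩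
  · have h := DihedralGroup.exists_conj_equiv_sr
      ((Z2Z2.dihedralEquiv.symm.trans φ).trans Z2Z2.dihedralEquiv)
    simp only [← Z2Z2.dihedralEquiv_a, ← Z2Z2.dihedralEquiv_b, MulEquiv.trans_apply,
      MulEquiv.symm_apply_apply] at h
    exact h.imp (fun ⟨d, ha, hb⟩ => Z2Z2.exists_conj_of_dihedral φ (.refl _) d ha hb)
      (fun ⟨d, ha, hb⟩ => Z2Z2.exists_conj_of_dihedral φ switchAut d ha hb)
  · have h := congrArg Coprod.fst (hg Z2Z2.a)
    rw [Z2Z2.switchAut_a, map_mul, map_mul, map_inv, mul_right_comm, mul_inv_cancel, one_mul] at h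
    exact absurd (show (1 : Multiplicative (ZMod 2)) = Multiplicative.ofAdd 1 from h) (by decide)
end

section
/- Let n ≥ 3 and let Q = (S^{n-1} × S¹)/σ be the quotient of S^{n-1} × S¹ by the fixed-point free involution σ(w, z) = (−w, z̄). Then for every basepoint q ∈ Q, the fundamental group of Q at q is isomorphic to the infinite dihedral group D∞ (equivalently, to the free product ℤ₂ * ℤ₂). -/
open Metric

/-- The unit sphere `S^{n-1}` in Euclidean `n`-space. -/
abbrev Sph (n : ℕ) : Type := sphere (0 : EuclideanSpace ℝ (Fin n)) 1

/-- The involution `σ(w, z) = (−w, z̄)` on `S^{n-1} × S¹`, where conjugation on the unit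
circle is inversion. -/
noncomputable def sigmaMap (n : ℕ) : Sph n × Circle → Sph n × Circle :=
  fun p => (-p.1, p.2⁻¹)

lemma sigmaMap_sigmaMap (n : ℕ) (p : Sph n × Circle) : sigmaMap n (sigmaMap n p) = p := by
  simp [sigmaMap]

/-- The equivalence relation on `S^{n-1} × S¹` identifying `(w, z)` with `σ(w, z)`. -/
noncomputable def sigmaSetoid (n : ℕ) : Setoid (Sph n × Circle) where
  r p q := q = p ∨ q = sigmaMap n p
  iseqv := by
    refine ⟨fun p => Or.inl rfl, ?_, ?_⟩
    · rintro p q (rfl | rfl)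
      · exact Or.inl rfl
      · exact Or.inr (sigmaMap_sigmaMap n p).symm
    · rintro p q r (rfl | rfl) (rfl | rfl)
      · exact Or.inl rfl
      · exact Or.inr rfl
      · exact Or.inr rfl
      · exact Or.inl (sigmaMap_sigmaMap n p)

/-- The quotient space `Q = (S^{n-1} × S¹)/σ`, a model for `Pⁿ # Pⁿ`. -/
abbrev QuotSpace (n : ℕ) : Type := Quotient (sigmaSetoid n)

open unitInterval Real

section Sphere

variable {E : Type*} [NormedAddCommGroup E] [InnerProductSpace ℝ E]

theorem isSimplyConnected_sphere_compl_singleton (v : sphere (0 : E) 1) :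
    IsSimplyConnected ({v}ᶜ : Set (sphere (0 : E) 1)) := by
  have e := (stereographic (norm_eq_of_mem_sphere v)).toHomeomorphSourceTarget
  have : ContractibleSpace (stereographic (norm_eq_of_mem_sphere v)).target :=
    (Homeomorph.Set.univ _).contractibleSpace
  exact e.toHomotopyEquiv.simplyConnectedSpace

theorem exists_contDiff_approx_path {x y : E} (γ : Path x y) {ε : ℝ} (hε : 0 < ε) :
    ∃ p : ℝ → E, ContDiff ℝ 1 p ∧ p 0 = x ∧ p 1 = y ∧ ∀ t : I, ‖p t - γ t‖ < ε := by
  obtain ⟨n, hn, hn0⟩ := ((Metric.tendsto_nhds.1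
    (bernsteinApproximation_uniform (γ : C(I, E))) ε hε).and
      (Filter.eventually_ne_atTop 0)).exists
  have key (t : I) : ∑ k : Fin (n + 1),
      ((n.choose k : ℝ) * (t : ℝ) ^ (k : ℕ) * (1 - (t : ℝ)) ^ (n - k)) • γ (bernstein.z k) =
      bernsteinApproximation n (γ : C(I, E)) t := by
    simp [bernsteinApproximation.apply, bernstein_apply]
  refine ⟨fun t ↦ ∑ k : Fin (n + 1),
    ((n.choose k : ℝ) * t ^ (k : ℕ) * (1 - t) ^ (n - k)) • γ (bernstein.z k), by fun_prop,
    ?_, ?_, fun t ↦ ?_⟩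
  · simpa using key 0
  · simpa [hn0] using key 1
  · dsimp only
    rw [key, ← dist_eq_norm]
    exact (ContinuousMap.dist_apply_le_dist t).trans_lt hn

theorem exists_mem_sphere_forall_smul_ne [FiniteDimensional ℝ E] (hE : 2 < Module.finrank ℝ E)
    {p : ℝ → E} (hp : ContDiff ℝ 1 p) :
    ∃ v : sphere (0 : E) 1, ∀ s t : ℝ, s • p t ≠ v := by
  have hd : Dense (Set.range fun q : ℝ × ℝ ↦ q.1 • p q.2)ᶜ :=
    ContDiff.dense_compl_range_of_finrank_lt_finrank (by fun_prop) (by simpa using hE)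
  obtain ⟨u, hu⟩ := hd.nonempty
  have h (s t : ℝ) : s • p t ≠ u := fun hst ↦ hu ⟨(s, t), hst⟩
  have hu0 : u ≠ 0 := by rintro rfl; exact h 0 0 (zero_smul _ _)
  refine ⟨⟨‖u‖⁻¹ • u, by simp [norm_smul, hu0]⟩, fun s t hst ↦ h (‖u‖ * s) t ?_⟩
  rw [mul_smul, hst]
  simp [smul_smul, hu0]

/-- Radial projection onto the unit sphere. -/
noncomputable def sphereNormalize (x : E) (hx : x ≠ 0) : sphere (0 : E) 1 :=
  ⟨‖x‖⁻¹ • x, by simp [norm_smul, hx]⟩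

theorem Continuous.sphereNormalize {X : Type*} [TopologicalSpace X] {f : X → E}
    (hf : Continuous f) (h0 : ∀ a, f a ≠ 0) :
    Continuous fun a ↦ _root_.sphereNormalize (f a) (h0 a) :=
  ((hf.norm.inv₀ fun a ↦ norm_ne_zero_iff.2 (h0 a)).smul hf).subtype_mk _

theorem Path.exists_homotopic_forall_ne_sphere [FiniteDimensional ℝ E]
    (hE : 2 < Module.finrank ℝ E) {x y : sphere (0 : E) 1} (γ : Path x y) :
    ∃ (δ : Path x y) (v : sphere (0 : E) 1), γ.Homotopic δ ∧ ∀ t, δ t ≠ v := by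
  obtain ⟨p, hp, hp0, hp1, hpγ⟩ :=
    exists_contDiff_approx_path (γ.map continuous_subtype_val) one_pos
  obtain ⟨v, hv⟩ := exists_mem_sphere_forall_smul_ne hE hp
  have hne (q : I × I) : (γ q.2 : E) + (q.1 : ℝ) • (p q.2 - γ q.2) ≠ 0 := by
    intro h
    have h1 : ‖(q.1 : ℝ) • (p q.2 - γ q.2)‖ < 1 := by
      rw [norm_smul, Real.norm_of_nonneg q.1.2.1]
      exact (mul_le_of_le_one_left (norm_nonneg _) q.1.2.2).trans_lt (hpγ q.2)
    rw [eq_neg_of_add_eq_zero_right h, norm_neg, norm_eq_of_mem_sphere] at h1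
    exact lt_irrefl _ h1
  have hcont : Continuous fun q : I × I ↦ sphereNormalize _ (hne q) :=
    Continuous.sphereNormalize (by have := hp.continuous; fun_prop) hne
  let δ : Path x y :=
    { toFun := fun t ↦ sphereNormalize _ (hne (1, t))
      continuous_toFun := hcont.comp (by fun_prop)
      source' := by ext1; simp [sphereNormalize, hp0]
      target' := by ext1; simp [sphereNormalize, hp1] }
  refine ⟨δ, v, ⟨{
    toFun := fun q ↦ sphereNormalize _ (hne q)
    continuous_toFun := hcont
    map_zero_left := fun t ↦ by ext1; simp [sphereNormalize]
    map_one_left := fun t ↦ rfl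
    prop' := ?_ }⟩, ?_⟩
  · rintro s t (rfl | rfl) <;> ext1 <;> simp [sphereNormalize, hp0, hp1]
  · rintro t rfl
    exact hv ‖p t‖⁻¹ t (by simp [δ, sphereNormalize])

theorem simplyConnectedSpace_sphere [FiniteDimensional ℝ E] (hE : 2 < Module.finrank ℝ E) :
    SimplyConnectedSpace (sphere (0 : E) 1) := by
  rw [simply_connected_iff_loops_nullhomotopic]
  constructor
  · rw [← isPathConnected_iff_pathConnectedSpace]
    refine isPathConnected_sphere ?_ 0 zero_le_one
    rw [← Module.finrank_eq_rank]
    exact_mod_cast (by omega : 1 < Module.finrank ℝ E)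
  · intro x γ
    obtain ⟨δ, v, hγδ, hδ⟩ := γ.exists_homotopic_forall_ne_sphere hE
    obtain ⟨F, -⟩ := (isSimplyConnected_iff_exists_homotopy_refl_forall_mem.1
      (isSimplyConnected_sphere_compl_singleton v)).2 x δ hδ
    exact hγδ.trans ⟨F⟩

end Sphere

theorem SimplyConnectedSpace.prod_of_contractible (X Y : Type*) [TopologicalSpace X]
    [TopologicalSpace Y] [SimplyConnectedSpace X] [ContractibleSpace Y] :
    SimplyConnectedSpace (X × Y) :=
  (((ContinuousMap.HomotopyEquiv.refl X).prodCongr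
    (ContractibleSpace.hequiv Y Unit).some).trans
    (Homeomorph.prodPUnit X).toHomotopyEquiv).simplyConnectedSpace

/-- The action of the infinite dihedral group on `S^{n-1} × ℝ`, in which `r k` translates the
line by `2πk` and `sr k` combines the antipodal map with the reflection `t ↦ -t - 2πk`. -/
noncomputable instance dihedralMulAction (n : ℕ) : MulAction (DihedralGroup 0) (Sph n × ℝ) where
  smul g p := match g with
    | .r k => (p.1, p.2 + Int.cast (R := ℝ) k * (2 * π))
    | .sr k => (-p.1, -p.2 - Int.cast (R := ℝ) k * (2 * π))
  one_smul p := Prod.ext rfl (by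
    change p.2 + ((0 : ℤ) : ℝ) * (2 * π) = p.2
    simp)
  mul_smul g h p := by
    rcases g with (i : ℤ) | (i : ℤ) <;> rcases h with (j : ℤ) | (j : ℤ)
    · refine Prod.ext rfl ?_
      change p.2 + ((i + j : ℤ) : ℝ) * (2 * π) = p.2 + (j : ℝ) * (2 * π) + (i : ℝ) * (2 * π)
      push_cast; ring
    · refine Prod.ext rfl ?_
      change -p.2 - ((j - i : ℤ) : ℝ) * (2 * π) = -p.2 - (j : ℝ) * (2 * π) + (i : ℝ) * (2 * π)
      push_cast; ring
    · refine Prod.ext rfl ?_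
      change -p.2 - ((i + j : ℤ) : ℝ) * (2 * π) = -(p.2 + (j : ℝ) * (2 * π)) - (i : ℝ) * (2 * π)
      push_cast; ring
    · refine Prod.ext (neg_neg _).symm ?_
      change p.2 + ((j - i : ℤ) : ℝ) * (2 * π) = -(-p.2 - (j : ℝ) * (2 * π)) - (i : ℝ) * (2 * π)
      push_cast; ring

theorem r_smul_eq {n : ℕ} (k : ℤ) (p : Sph n × ℝ) :
    (DihedralGroup.r k : DihedralGroup 0) • p = (p.1, p.2 + k * (2 * π)) := rfl

theorem sr_smul_eq {n : ℕ} (k : ℤ) (p : Sph n × ℝ) :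
    (DihedralGroup.sr k : DihedralGroup 0) • p = (-p.1, -p.2 - k * (2 * π)) := rfl

/-- The universal covering `S^{n-1} × ℝ → Q`. -/
noncomputable def coveringToQuot (n : ℕ) (p : Sph n × ℝ) : QuotSpace n :=
  Quotient.mk _ (p.1, Circle.exp p.2)

theorem coveringToQuot_eq_iff {n : ℕ} {p q : Sph n × ℝ} :
    coveringToQuot n p = coveringToQuot n q ↔ p ∈ MulAction.orbit (DihedralGroup 0) q := by
  have h : coveringToQuot n p = coveringToQuot n q ↔
      (q.1, Circle.exp q.2) = (p.1, Circle.exp p.2) ∨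
      (q.1, Circle.exp q.2) = sigmaMap n (p.1, Circle.exp p.2) := Quotient.eq
  rw [h, MulAction.mem_orbit_iff]
  simp only [sigmaMap, Prod.mk.injEq, ← Circle.exp_neg, Circle.exp_eq_exp]
  constructor
  · rintro (⟨h1, m, hm⟩ | ⟨h1, m, hm⟩)
    · exact ⟨.r (-m : ℤ), Prod.ext h1 (by rw [r_smul_eq]; push_cast; linarith)⟩
    · exact ⟨.sr (-m : ℤ), Prod.ext (by simp [sr_smul_eq, h1])
        (by rw [sr_smul_eq]; push_cast; linarith)⟩
  · rintro ⟨(k : ℤ) | (k : ℤ), rfl⟩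
    · exact Or.inl ⟨rfl, -k, by rw [r_smul_eq]; push_cast; ring⟩
    · exact Or.inr ⟨(neg_neg _).symm, -k, by rw [sr_smul_eq]; push_cast; ring⟩

theorem isQuotientCoveringMap_coveringToQuot (n : ℕ) :
    IsQuotientCoveringMap (coveringToQuot n) (DihedralGroup 0) where
  toIsQuotientMap := by
    have h : IsOpenQuotientMap (Prod.map id Circle.exp : Sph n × ℝ → Sph n × Circle) :=
      IsOpenQuotientMap.id.prodMap
        ⟨Circle.exp_surjective, Circle.exp.continuous, Circle.isCoveringMap_exp.isOpenMap⟩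
    exact isQuotientMap_quotient_mk'.comp h.isQuotientMap
  continuous_const_smul g := by
    rcases g with (k : ℤ) | (k : ℤ)
    · simp only [r_smul_eq]; fun_prop
    · simp only [sr_smul_eq]; fun_prop
  apply_eq_iff_mem_orbit := coveringToQuot_eq_iff
  disjoint p := by
    refine ⟨ball p 1, ball_mem_nhds p one_pos, ?_⟩
    rintro ((k : ℤ) | (k : ℤ)) ⟨_, ⟨q, hq, rfl⟩, hq'⟩
    · simp only [r_smul_eq, mem_ball, Prod.dist_eq, max_lt_iff, Real.dist_eq, abs_lt] at hq hq'
      have h3 := Real.pi_gt_three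
      have hk : k = 0 := by
        have h1 : (k : ℝ) < 1 := by nlinarith
        have h2 : (-1 : ℝ) < k := by nlinarith
        norm_cast at h1 h2
        omega
      subst hk
      rfl
    · exfalso
      simp only [sr_smul_eq, mem_ball, Prod.dist_eq, max_lt_iff] at hq hq'
      have h : dist (-q.1) q.1 < 2 := by
        linarith [dist_triangle_right (-q.1) q.1 p.1, hq.1, hq'.1]
      rw [Subtype.dist_eq, dist_eq_norm] at h
      have : ((-q.1 : Sph n) : EuclideanSpace ℝ (Fin n)) - q.1 =
          (-2 : ℝ) • (q.1 : EuclideanSpace ℝ (Fin n)) := by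
        simp only [coe_neg_sphere]; module
      rw [this, norm_smul, norm_eq_of_mem_sphere] at h
      norm_num at h

/-- For `n ≥ 3`, the fundamental group of `Q = (S^{n-1} × S¹)/σ` (the model for `Pⁿ # Pⁿ`)
at any basepoint is isomorphic to the infinite dihedral group `D∞` (equivalently, to
`ℤ₂ * ℤ₂`). -/
theorem fundamentalGroup_quotSpace_iso_infinite_dihedral (n : ℕ) (hn : 3 ≤ n) :
    ∀ q : QuotSpace n,
      Nonempty (FundamentalGroup (QuotSpace n) q ≃* DihedralGroup 0) := by
  intro q
  have : SimplyConnectedSpace (Sph n) :=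
    simplyConnectedSpace_sphere (by rwa [finrank_euclideanSpace_fin])
  have : SimplyConnectedSpace (Sph n × ℝ) := .prod_of_contractible _ _
  have hf := isQuotientCoveringMap_coveringToQuot n
  obtain ⟨e, he⟩ := hf.surjective q
  exact ⟨(hf.fundamentalGroupEquiv ⟨e, he⟩).trans (MulEquiv.inv' _).symm⟩
end

section
/- Let 𝔽₂ be the field with two elements and let X𝔽₂[X] denote the additive group of polynomials over 𝔽₂ with zero constant term. For every f ∈ X𝔽₂[X] there exists a unique polynomial g ∈ X𝔽₂[X] all of whose nonzero monomials have odd degree, such that f + g lies in the set {h² + h : h ∈ 𝔽₂[X]}. (Equivalently: the classes of the odd-degree monomials X^d, d odd, form an 𝔽₂-basis of the quotient group X𝔽₂[X]/{h² + h : h ∈ 𝔽₂[X]}, so this quotient is an infinite direct sum of copies of ℤ₂.) -/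
open Polynomial

namespace ArtinSchreier

/-- `f` is congruent, modulo the image of `h ↦ h ^ 2 + h`, to a polynomial whose nonzero
monomials all have odd degree. -/
def HasOddRepresentative (f : Polynomial (ZMod 2)) : Prop :=
  ∃ g : Polynomial (ZMod 2), (∀ d : ℕ, g.coeff d ≠ 0 → Odd d) ∧
    ∃ h : Polynomial (ZMod 2), f + g = h ^ 2 + h

theorem HasOddRepresentative.zero : HasOddRepresentative 0 :=
  ⟨0, by simp, 0, by simp⟩

theorem HasOddRepresentative.add {f₁ f₂ : Polynomial (ZMod 2)}
    (hf₁ : HasOddRepresentative f₁) (hf₂ : HasOddRepresentative f₂) :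
    HasOddRepresentative (f₁ + f₂) := by
  obtain ⟨g₁, hg₁, h₁, e₁⟩ := hf₁
  obtain ⟨g₂, hg₂, h₂, e₂⟩ := hf₂
  refine ⟨g₁ + g₂, fun d hd => ?_, h₁ + h₂, ?_⟩
  · by_cases hd₁ : g₁.coeff d = 0
    · exact hg₂ d (by simpa [hd₁] using hd)
    · exact hg₁ d hd₁
  · rw [CharTwo.add_sq]
    linear_combination e₁ + e₂

theorem HasOddRepresentative.X_pow (n : ℕ) (hn : n ≠ 0) :
    HasOddRepresentative (X ^ n) := by
  induction n using Nat.strong_induction_on with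
  | _ n ih =>
    rcases Nat.even_or_odd' n with ⟨m, rfl | rfl⟩
    · obtain ⟨g, hg, h, e⟩ := ih m (by lia) (by lia)
      refine ⟨g, hg, X ^ m + h, ?_⟩
      rw [CharTwo.add_sq]
      linear_combination e - CharTwo.add_self_eq_zero (X ^ m : Polynomial (ZMod 2))
    · refine ⟨X ^ (2 * m + 1), fun d hd => ?_, 0, by simp [CharTwo.add_self_eq_zero]⟩
      have hd' : d = 2 * m + 1 := by
        by_contra hne
        exact hd (by rw [coeff_X_pow, if_neg hne])
      exact ⟨m, hd'⟩

theorem hasOddRepresentative_of_coeff_zero (f : Polynomial (ZMod 2)) (hf : f.coeff 0 = 0) :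
    HasOddRepresentative f := by
  rw [f.as_sum_support_C_mul_X_pow]
  refine Finset.sum_induction _ _ (fun _ _ => .add) .zero fun n hn => ?_
  have hc : f.coeff n ≠ 0 := mem_support_iff.mp hn
  have hc1 : f.coeff n = 1 := by
    generalize f.coeff n = a at hc
    revert hc
    decide +revert
  rw [hc1, C_1, one_mul]
  exact .X_pow n fun h => hc (h ▸ hf)

/-- The image of `h ↦ h ^ 2 + h` meets the polynomials with only odd-degree monomials
trivially. -/
theorem eq_zero_of_odd_of_eq_sq_add_self {g k : Polynomial (ZMod 2)}
    (hg : ∀ d : ℕ, g.coeff d ≠ 0 → Odd d) (hk : g = k ^ 2 + k) : g = 0 := by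
  have hcoeff : k.natDegree ≠ 0 → g.coeff (k.natDegree * 2) ≠ 0 := by
    intro hn
    rw [hk, coeff_add, ← ZMod.expand_card, coeff_expand_mul (by norm_num),
      coeff_eq_zero_of_natDegree_lt (p := k) (n := k.natDegree * 2) (by lia), add_zero]
    exact leadingCoeff_ne_zero.mpr fun h => hn (by simp [h])
  have hn : k.natDegree = 0 := by
    by_contra hn
    have := hg _ (hcoeff hn)
    rw [Nat.odd_iff] at this
    lia
  rw [eq_C_of_natDegree_eq_zero hn, ← C_pow, ZMod.pow_card, CharTwo.add_self_eq_zero] at hk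
  exact hk

end ArtinSchreier

/-- For every polynomial `f` over `𝔽₂` with zero constant term there is a unique
polynomial `g`, all of whose nonzero monomials have odd degree (so in particular `g` has
zero constant term), such that `f + g` lies in the image `{h² + h : h ∈ 𝔽₂[X]}` of the
Artin–Schreier map.  Equivalently, the classes of the odd-degree monomials form an
`𝔽₂`-basis of `X𝔽₂[X]/{h² + h}`, so this quotient is an infinite direct sum of copies
of `ℤ₂`. -/
theorem exists_unique_odd_representative (f : Polynomial (ZMod 2)) (hf : f.coeff 0 = 0) :
    ∃! g : Polynomial (ZMod 2),
      (∀ d : ℕ, g.coeff d ≠ 0 → Odd d) ∧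
      ∃ h : Polynomial (ZMod 2), f + g = h ^ 2 + h := by
  obtain ⟨g, hg, h, e⟩ := ArtinSchreier.hasOddRepresentative_of_coeff_zero f hf
  refine ⟨g, ⟨hg, h, e⟩, ?_⟩
  rintro g' ⟨hg', h', e'⟩
  refine CharTwo.add_eq_zero.mp
    (ArtinSchreier.eq_zero_of_odd_of_eq_sq_add_self (k := h' + h) (fun d hd => ?_) ?_)
  · by_cases hd' : g'.coeff d = 0
    · exact hg d (by simpa [hd'] using hd)
    · exact hg' d hd'
  · rw [CharTwo.add_sq]
    linear_combination e' + e - CharTwo.add_self_eq_zero f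
end
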